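/- Fix an associativity N ≥ 1, a type A of memory-block addresses with decidable equality, a distinguished block a : A, and a trace t : List A. Then the a-focused abstraction of the LRU cache state obtained by executing t from the empty cache is computed as follows: if a does not occur in t, it equals none; and if t = t1 ++ (a :: t2) with a ∉ t2, then it equals some (the set of distinct addresses occurring in t2) if the number of distinct addresses in t2 is less than N, and none otherwise. -/

import Mathlib

/-- An LRU cache of associativity `N` is a list of pairwise distinct addresses,
youngest first. Accessing block `b` rejuvenates `b` (or loads it) and keeps
only the `N` youngest blocks. -/
def lruAccess {A : Type*} [DecidableEq A] (N : ℕ) (s : List A) (b : A) : List A :=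
  ((b :: s.erase b).take N)

/-- The LRU cache state of associativity `N` obtained by executing trace `t`
from the empty cache. -/
def lruRun {A : Type*} [DecidableEq A] (N : ℕ) (t : List A) : List A :=
  t.foldl (lruAccess N) []

/-- The `a`-focused abstraction of a concrete LRU cache state: `some` of the set
of blocks younger than `a` if `a` is in the cache, `none` (𝒜) otherwise. -/
def lruFocus {A : Type*} [DecidableEq A] (a : A) (s : List A) : Option (Finset A) :=
  if a ∈ s then some (s.takeWhile (fun x => decide (x ≠ a))).toFinset else none

theorem mem_of_mem_lruAccess {A : Type*} [DecidableEq A] {N : ℕ} {s : List A} {b x : A}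
    (h : x ∈ lruAccess N s b) : x = b ∨ x ∈ s :=
  (List.mem_cons.mp (List.mem_of_mem_take h)).imp_right List.mem_of_mem_erase

theorem mem_of_mem_lruRun {A : Type*} [DecidableEq A] {N : ℕ} {t : List A} {x : A}
    (h : x ∈ lruRun N t) : x ∈ t := by
  induction t using List.reverseRecOn with
  | nil => exact h
  | append_singleton t b ih =>
    rw [lruRun, List.foldl_concat] at h
    rcases mem_of_mem_lruAccess h with rfl | h
    · simp
    · exact List.mem_append_left _ (ih h)

/-- The cache state `s` results from accessing exactly the blocks of `F`, none of them `a`,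
after an access to `a`: either `F` is the set of blocks in front of `a`, or `a` was evicted
because `F` has at least `N` elements. -/
def LruYounger {A : Type*} [DecidableEq A] (N : ℕ) (a : A) (F : Finset A) (s : List A) : Prop :=
  (∃ p q, s = p ++ a :: q ∧ p.Nodup ∧ a ∉ p ∧ p.toFinset = F ∧ p.length < N) ∨
    (a ∉ s ∧ N ≤ F.card)

theorem LruYounger.access {A : Type*} [DecidableEq A] {N : ℕ} {a b : A} {F : Finset A}
    {s : List A} (h : LruYounger N a F s) (hb : b ≠ a) :
    LruYounger N a (insert b F) (lruAccess N s b) := by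
  rcases h with ⟨p, q, rfl, hp, hap, rfl, hlen⟩ | ⟨has, hcard⟩
  · by_cases hbp : b ∈ p
    · have hl : (b :: p.erase b).length = p.length := by
        have := List.length_pos_of_mem hbp
        rw [List.length_cons, List.length_erase_of_mem hbp]
        omega
      obtain ⟨m, hm⟩ : ∃ m, N - (b :: p.erase b).length = m + 1 :=
        ⟨N - p.length - 1, by omega⟩
      refine Or.inl ⟨b :: p.erase b, q.take m, ?_, ?_, ?_, ?_, by omega⟩
      · rw [lruAccess, List.erase_append_left _ hbp, ← List.cons_append,
          List.take_append, hm, List.take_of_length_le (by omega), List.take_succ_cons]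
      · exact List.nodup_cons.mpr ⟨hp.not_mem_erase, hp.erase b⟩
      · simp [hb.symm, List.mem_erase_of_ne hb.symm, hap]
      · ext x
        by_cases hx : x = b <;> simp [hx]
    · have hacc : lruAccess N (p ++ a :: q) b
          = (b :: p) ++ (a :: q.erase b).take (N - (p.length + 1)) := by
        rw [lruAccess, List.erase_append_right _ hbp,
          List.erase_cons_tail (by simpa using hb.symm), ← List.cons_append, List.take_append,
          List.take_of_length_le (by simpa using hlen), List.length_cons]
      rw [hacc]
      have hap' : a ∉ b :: p := by simp [hap, hb.symm]
      rcases Nat.lt_or_ge (p.length + 1) N with hlt | hge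
      · obtain ⟨m, hm⟩ : ∃ m, N - (p.length + 1) = m + 1 := ⟨N - (p.length + 1) - 1, by omega⟩
        rw [hm]
        exact Or.inl ⟨b :: p, (q.erase b).take m, rfl, List.nodup_cons.mpr ⟨hbp, hp⟩, hap',
          List.toFinset_cons, hlt⟩
      · refine Or.inr ⟨by simpa [Nat.sub_eq_zero_of_le hge] using hap', ?_⟩
        rw [Finset.card_insert_of_notMem (by simpa using hbp), List.toFinset_card_of_nodup hp]
        exact hge
  · exact Or.inr ⟨fun h => (mem_of_mem_lruAccess h).elim hb.symm has,
      hcard.trans (Finset.card_le_card (Finset.subset_insert b F))⟩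

theorem LruYounger.foldl_lruAccess {A : Type*} [DecidableEq A] {N : ℕ} {a : A} {s : List A}
    (h : LruYounger N a ∅ s) {t : List A} (ht : a ∉ t) :
    LruYounger N a t.toFinset (t.foldl (lruAccess N) s) := by
  induction t using List.reverseRecOn with
  | nil => exact h
  | append_singleton t b ih =>
    simp only [List.mem_append, List.mem_singleton, not_or] at ht
    rw [List.foldl_concat, List.toFinset_append, Finset.union_comm]
    exact (ih ht.1).access (Ne.symm ht.2)

theorem lruYounger_lruAccess_self {A : Type*} [DecidableEq A] {N : ℕ} (hN : 1 ≤ N) (a : A)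
    (s : List A) : LruYounger N a ∅ (lruAccess N s a) := by
  obtain ⟨m, rfl⟩ := Nat.exists_eq_add_of_le' hN
  exact Or.inl ⟨[], (s.erase a).take m, rfl, List.nodup_nil, List.not_mem_nil, rfl, hN⟩

theorem LruYounger.lruFocus_eq {A : Type*} [DecidableEq A] {N : ℕ} {a : A} {F : Finset A}
    {s : List A} (h : LruYounger N a F s) :
    lruFocus a s = if F.card < N then some F else none := by
  rcases h with ⟨p, q, rfl, hp, hap, rfl, hlen⟩ | ⟨has, hcard⟩
  · have htake : (p ++ a :: q).takeWhile (fun x => decide (x ≠ a)) = p := by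
      rw [List.takeWhile_append_of_pos fun x hx => decide_eq_true (ne_of_mem_of_not_mem hx hap)]
      simp
    rw [lruFocus, if_pos (by simp), htake, List.toFinset_card_of_nodup hp, if_pos hlen]
  · rw [lruFocus, if_neg has, if_neg hcard.not_gt]

/-- The `a`-focused abstraction of the state reached by a trace is `none` if `a`
does not occur, and otherwise is determined by the set of distinct addresses
accessed after the last access to `a`. -/
theorem lruFocus_run {A : Type*} [DecidableEq A] (N : ℕ) (hN : 1 ≤ N) (a : A)
    (t : List A) :
    (a ∉ t → lruFocus a (lruRun N t) = none) ∧
    (∀ t1 t2 : List A, t = t1 ++ a :: t2 → a ∉ t2 →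
        lruFocus a (lruRun N t) =
          if t2.toFinset.card < N then some t2.toFinset else none) := by
  refine ⟨fun ha => if_neg fun h => ha (mem_of_mem_lruRun h), ?_⟩
  rintro t1 t2 rfl ha
  rw [lruRun, List.foldl_append, List.foldl_cons]
  exact ((lruYounger_lruAccess_self hN a _).foldl_lruAccess ha).lruFocus_eq
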